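/- For every n ≥ 1 and every nonempty rational polyhedron P ⊆ [0,1]^n, the unital ℓ-group (M_n↾P, 1) is hopfian: every surjective unital ℓ-endomorphism of (M_n↾P, 1) is injective. (By Baker–Beynon type duality, the algebras (M_n↾P, 1) are exactly the finitely presented unital ℓ-groups, so this says every finitely presented unital ℓ-group is hopfian.) -/

import Mathlib

open Set BigOperators

/-- The unit cube `[0,1]^n` as a subset of `Fin n → ℝ`. -/
def cube (n : ℕ) : Set (Fin n → ℝ) := Set.Icc 0 1

/-- An (affine) linear polynomial with integer coefficients. -/
def IsAffineZ {n : ℕ} (p : (Fin n → ℝ) → ℝ) : Prop :=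
  ∃ (m : ℤ) (c : Fin n → ℤ), ∀ x, p x = (m : ℝ) + ∑ i, (c i : ℝ) * x i

/-- An element of `M_n`: a continuous real-valued function on `[0,1]^n` that agrees at each
point of the cube with one of finitely many affine polynomials with integer coefficients. -/
def IsPWLZ {n : ℕ} (f : (Fin n → ℝ) → ℝ) : Prop :=
  ContinuousOn f (cube n) ∧
  ∃ (u : ℕ) (p : Fin u → (Fin n → ℝ) → ℝ),
    (∀ j, IsAffineZ (p j)) ∧ ∀ x ∈ cube n, ∃ j, f x = p j x

/-- `Mres X = M_n↾X`: restrictions to `X` of elements of `M_n`. -/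
def Mres {n : ℕ} (X : Set (Fin n → ℝ)) : Set (↥X → ℝ) :=
  {g : ↥X → ℝ | ∃ f, IsPWLZ (n := n) f ∧ ∀ x : X, g x = f x.1}

/-- A unital ℓ-endomorphism of `(M_n↾X, 1)`: preserves `+`, `⊔`, `⊓` (pointwise) and the
unit (the constant function `1`). -/
def IsUnitalLEndo {n : ℕ} (X : Set (Fin n → ℝ)) (σ : (↥X → ℝ) → (↥X → ℝ)) : Prop :=
  Set.MapsTo σ (Mres X) (Mres X) ∧
  (∀ f ∈ Mres X, ∀ g ∈ Mres X, σ (f + g) = σ f + σ g) ∧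
  (∀ f ∈ Mres X, ∀ g ∈ Mres X, σ (f ⊔ g) = σ f ⊔ σ g) ∧
  (∀ f ∈ Mres X, ∀ g ∈ Mres X, σ (f ⊓ g) = σ f ⊓ σ g) ∧
  σ 1 = 1

/-- A point all of whose coordinates are rational. -/
def IsRationalPoint {n : ℕ} (x : Fin n → ℝ) : Prop := ∀ i, ∃ q : ℚ, x i = (q : ℝ)

/-- A rational polyhedron in `[0,1]^n`: a finite union of convex hulls of finite sets of
rational points of `[0,1]^n`. -/
def IsRatPolyhedron {n : ℕ} (P : Set (Fin n → ℝ)) : Prop :=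
  ∃ F : Finset (Finset (Fin n → ℝ)),
    (∀ S ∈ F, ∀ v ∈ S, IsRationalPoint v ∧ v ∈ cube n) ∧
    P = ⋃ S ∈ F, convexHull ℝ (S : Set (Fin n → ℝ))

lemma IsPWLZ.of_isAffineZ {n : ℕ} {p : (Fin n → ℝ) → ℝ} (hp : IsAffineZ p) : IsPWLZ p := by
  refine ⟨?_, 1, fun _ => p, fun _ => hp, fun x _ => ⟨0, rfl⟩⟩
  obtain ⟨m, c, h⟩ := hp
  rw [funext h]
  fun_prop

lemma IsAffineZ.add {n : ℕ} {p q : (Fin n → ℝ) → ℝ} (hp : IsAffineZ p) (hq : IsAffineZ q) :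
    IsAffineZ (p + q) := by
  obtain ⟨m, c, h⟩ := hp
  obtain ⟨m', c', h'⟩ := hq
  refine ⟨m + m', c + c', fun x => ?_⟩
  simp only [Pi.add_apply, h, h', Int.cast_add, add_mul, Finset.sum_add_distrib]
  ring

lemma IsAffineZ.neg {n : ℕ} {p : (Fin n → ℝ) → ℝ} (hp : IsAffineZ p) : IsAffineZ (-p) := by
  obtain ⟨m, c, h⟩ := hp
  refine ⟨-m, -c, fun x => ?_⟩
  simp only [Pi.neg_apply, h, Int.cast_neg, neg_mul, Finset.sum_neg_distrib]
  ring

lemma isAffineZ_intCast {n : ℕ} (k : ℤ) : IsAffineZ (n := n) (fun _ => (k : ℝ)) :=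
  ⟨k, 0, fun x => by simp⟩

lemma isAffineZ_apply {n : ℕ} (i : Fin n) : IsAffineZ (fun x : Fin n → ℝ => x i) :=
  ⟨0, Pi.single i 1, fun x => by simp [Pi.single_apply]⟩

lemma IsPWLZ.add {n : ℕ} {f g : (Fin n → ℝ) → ℝ} (hf : IsPWLZ f) (hg : IsPWLZ g) :
    IsPWLZ (f + g) := by
  obtain ⟨cf, u, p, hp, hfp⟩ := hf
  obtain ⟨cg, v, q, hq, hgq⟩ := hg
  refine ⟨cf.add cg, u * v,
    fun j => p (finProdFinEquiv.symm j).1 + q (finProdFinEquiv.symm j).2,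
    fun j => (hp _).add (hq _), fun x hx => ?_⟩
  obtain ⟨i, hi⟩ := hfp x hx
  obtain ⟨j, hj⟩ := hgq x hx
  exact ⟨finProdFinEquiv (i, j), by simp [hi, hj]⟩

lemma IsPWLZ.neg {n : ℕ} {f : (Fin n → ℝ) → ℝ} (hf : IsPWLZ f) : IsPWLZ (-f) := by
  obtain ⟨cf, u, p, hp, hfp⟩ := hf
  refine ⟨cf.neg, u, fun j => -p j, fun j => (hp j).neg, fun x hx => ?_⟩
  obtain ⟨i, hi⟩ := hfp x hx
  exact ⟨i, by simp [hi]⟩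

lemma IsPWLZ.sup {n : ℕ} {f g : (Fin n → ℝ) → ℝ} (hf : IsPWLZ f) (hg : IsPWLZ g) :
    IsPWLZ (f ⊔ g) := by
  obtain ⟨cf, u, p, hp, hfp⟩ := hf
  obtain ⟨cg, v, q, hq, hgq⟩ := hg
  refine ⟨cf.sup cg, u + v, Fin.append p q, fun j => ?_, fun x hx => ?_⟩
  · refine Fin.addCases (fun i => ?_) (fun i => ?_) j
    · simpa using hp i
    · simpa using hq i
  · obtain ⟨i, hi⟩ := hfp x hx
    obtain ⟨j, hj⟩ := hgq x hx
    rcases le_total (f x) (g x) with h | h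
    · exact ⟨Fin.natAdd u j, by simp [← hj, h]⟩
    · exact ⟨Fin.castAdd v i, by simp [← hi, h]⟩

/-- `Mres X` as an additive subgroup of the group of all real functions on `X`. -/
def mresAddSubgroup {n : ℕ} (X : Set (Fin n → ℝ)) : AddSubgroup (↥X → ℝ) where
  carrier := Mres X
  add_mem' := by
    rintro a b ⟨f, hf, haf⟩ ⟨g, hg, hbg⟩
    exact ⟨f + g, hf.add hg, fun x => by simp [haf, hbg]⟩
  zero_mem' := ⟨_, .of_isAffineZ (isAffineZ_intCast 0), fun x => by simp⟩
  neg_mem' := by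
    rintro a ⟨f, hf, haf⟩
    exact ⟨-f, hf.neg, fun x => by simp [haf]⟩

lemma one_mem_Mres {n : ℕ} (X : Set (Fin n → ℝ)) : (1 : ↥X → ℝ) ∈ Mres X :=
  ⟨_, .of_isAffineZ (isAffineZ_intCast 1), fun x => by simp⟩

lemma coord_mem_Mres {n : ℕ} (X : Set (Fin n → ℝ)) (i : Fin n) :
    (fun x : ↥X => x.1 i) ∈ Mres X :=
  ⟨_, .of_isAffineZ (isAffineZ_apply i), fun _ => rfl⟩

lemma sup_mem_Mres {n : ℕ} {X : Set (Fin n → ℝ)} {a b : ↥X → ℝ} (ha : a ∈ Mres X)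
    (hb : b ∈ Mres X) : a ⊔ b ∈ Mres X := by
  obtain ⟨f, hf, haf⟩ := ha
  obtain ⟨g, hg, hbg⟩ := hb
  exact ⟨f ⊔ g, hf.sup hg, fun x => by simp [haf, hbg]⟩

lemma continuous_of_mem_Mres {n : ℕ} {X : Set (Fin n → ℝ)} (hX : X ⊆ cube n) {a : ↥X → ℝ}
    (ha : a ∈ Mres X) : Continuous a := by
  obtain ⟨f, hf, haf⟩ := ha
  rw [funext haf]
  exact continuousOn_iff_continuous_domRestrict.1 (hf.1.mono hX)

/-- Elements of `M_n` map points of denominator dividing `d` into `(1/d)ℤ`. -/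
lemma exists_int_of_mem_Mres {n : ℕ} {X : Set (Fin n → ℝ)} (hX : X ⊆ cube n) {a : ↥X → ℝ}
    (ha : a ∈ Mres X) {d : ℕ} {x : ↥X} (hx : ∀ i, ∃ k : ℤ, (d : ℝ) * x.1 i = k) :
    ∃ k : ℤ, (d : ℝ) * a x = k := by
  obtain ⟨f, ⟨-, u, p, hp, hfp⟩, haf⟩ := ha
  obtain ⟨j, hj⟩ := hfp x.1 (hX x.2)
  obtain ⟨m, c, h⟩ := hp j
  choose k hk using hx
  refine ⟨d * m + ∑ i, c i * k i, ?_⟩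
  rw [haf, hj, h, mul_add, Finset.mul_sum]
  push_cast
  congr 1
  refine Finset.sum_congr rfl fun i _ => ?_
  rw [← hk i]
  ring

/-- A unital ℓ-homomorphism from `M_n↾X` to `(1/d)ℤ` is the evaluation at some point of `X`. -/
lemma exists_eq_eval {n : ℕ} {X : Set (Fin n → ℝ)} (hX : X ⊆ cube n) (hc : IsCompact X)
    (hne : X.Nonempty) {φ : (↥X → ℝ) → ℝ}
    (hadd : ∀ f ∈ Mres X, ∀ g ∈ Mres X, φ (f + g) = φ f + φ g)
    (hsup : ∀ f ∈ Mres X, ∀ g ∈ Mres X, φ (f ⊔ g) = φ f ⊔ φ g)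
    (hone : φ 1 = 1) {d : ℕ} (hd : d ≠ 0)
    (hint : ∀ f ∈ Mres X, ∃ k : ℤ, (d : ℝ) * φ f = k) :
    ∃ y : ↥X, ∀ f ∈ Mres X, φ f = f y := by
  have : CompactSpace ↥X := isCompact_iff_compactSpace.1 hc
  have : Nonempty ↥X := hne.to_subtype
  let Φ : mresAddSubgroup X →+ ℝ :=
    AddMonoidHom.mk' (fun f => φ f.1) fun f g => hadd _ f.2 _ g.2
  let e : mresAddSubgroup X := ⟨1, one_mem_Mres X⟩
  have he : Φ e = 1 := hone
  have hmono : ∀ f g : mresAddSubgroup X, f.1 ≤ g.1 → Φ f ≤ Φ g := fun f g h => by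
    have := hsup _ f.2 _ g.2
    rw [sup_eq_right.2 h] at this
    exact sup_eq_right.1 this.symm
  obtain ⟨y, hy⟩ : ∃ y : ↥X, ∀ f : mresAddSubgroup X, Φ f = 0 → f.1 y = 0 := by
    by_contra! hcon
    have hpos : ∀ y : ↥X, ∃ g : mresAddSubgroup X, Φ g = 0 ∧ 0 ≤ g.1 ∧ 0 < g.1 y := by
      intro y
      obtain ⟨f, hf0, hfy⟩ := hcon y
      refine ⟨⟨f.1 ⊔ (-f).1, sup_mem_Mres f.2 (-f).2⟩, ?_, fun x => ?_, ?_⟩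
      · refine (hsup _ f.2 _ (-f).2).trans ?_
        change Φ f ⊔ Φ (-f) = 0
        simp [hf0]
      · exact abs_nonneg (f.1 x)
      · exact abs_pos.2 hfy
    choose g hg0 hgnn hgpos using hpos
    obtain ⟨t, ht⟩ := finite_cover_nhds (X := ↥X) (U := fun y => {x | 0 < (g y).1 x})
      fun y => (isOpen_lt continuous_const (continuous_of_mem_Mres hX (g y).2)).mem_nhds
        (hgpos y)
    let F : mresAddSubgroup X := ∑ y ∈ t, g y
    have hF0 : Φ F = 0 := by simp [F, hg0]
    have hFpos : ∀ x, 0 < F.1 x := fun x => by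
      have hx : x ∈ ⋃ y ∈ t, {x | 0 < (g y).1 x} := ht ▸ mem_univ x
      simp only [mem_iUnion, mem_ofPred_eq] at hx
      obtain ⟨y, hyt, hy⟩ := hx
      have : F.1 x = ∑ y ∈ t, (g y).1 x := by
        simp [F, Finset.sum_apply]
      rw [this]
      exact Finset.sum_pos' (fun i _ => hgnn i x) ⟨y, hyt, hy⟩
    obtain ⟨x₀, hx₀⟩ := (continuous_of_mem_Mres hX F.2).exists_forall_le_of_hasCompactSupport
      (HasCompactSupport.of_compactSpace _)
    obtain ⟨k, hk⟩ := exists_nat_ge (F.1 x₀)⁻¹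
    have hle : Φ e ≤ Φ (k • F) := hmono _ _ fun x => by
      have h1 : 1 ≤ k * F.1 x₀ := by
        rwa [inv_le_iff_one_le_mul₀ (hFpos x₀)] at hk
      have h2 : (k : ℝ) * F.1 x₀ ≤ k * F.1 x :=
        mul_le_mul_of_nonneg_left (hx₀ x) (Nat.cast_nonneg k)
      simpa [e] using h1.trans h2
    rw [map_nsmul, hF0, he, smul_zero] at hle
    exact absurd hle (by norm_num)
  refine ⟨y, fun f hf => ?_⟩
  obtain ⟨k, hk⟩ := hint f hf
  let f' : mresAddSubgroup X := ⟨f, hf⟩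
  have hker : Φ (d • f' - k • e) = 0 := by
    have : Φ f' = φ f := rfl
    simp [he, this, hk]
  have h := hy _ hker
  have h' : (d : ℝ) * f y - k = 0 := by simpa [f', e] using h
  have hd' : (d : ℝ) ≠ 0 := Nat.cast_ne_zero.2 hd
  exact mul_left_cancel₀ hd' (by linarith)

lemma Icc_subset_closure_rat :
    Icc (0 : ℝ) 1 ⊆ closure {t | t ∈ Icc (0 : ℝ) 1 ∧ ∃ q : ℚ, t = q} := by
  rw [← closure_Ioo (zero_ne_one' ℝ)]
  refine closure_minimal ?_ isClosed_closure
  refine (Rat.denseRange_cast.open_subset_closure_inter isOpen_Ioo).trans (closure_mono ?_)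
  rintro _ ⟨h, q, rfl⟩
  exact ⟨subset_closure h, q, rfl⟩

/-- Rational points are dense in the convex hull of a set of rational points. -/
lemma convexHull_subset_closure_rational {n : ℕ} {S : Set (Fin n → ℝ)}
    (hS : ∀ v ∈ S, IsRationalPoint v) :
    convexHull ℝ S ⊆ closure {x | x ∈ convexHull ℝ S ∧ IsRationalPoint x} := by
  refine convexHull_min (fun v hv => subset_closure ⟨subset_convexHull ℝ S hv, hS v hv⟩) ?_
  refine convex_iff_forall_pos.2 fun x hx y hy a b ha hb hab => ?_
  have haI : a ∈ closure {t | t ∈ Icc (0 : ℝ) 1 ∧ ∃ q : ℚ, t = q} :=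
    Icc_subset_closure_rat ⟨ha.le, by linarith⟩
  have hmem : (a, x, y) ∈ closure ({t | t ∈ Icc (0 : ℝ) 1 ∧ ∃ q : ℚ, t = q} ×ˢ
      ({x | x ∈ convexHull ℝ S ∧ IsRationalPoint x} ×ˢ
        {x | x ∈ convexHull ℝ S ∧ IsRationalPoint x})) := by
    rw [closure_prod_eq, closure_prod_eq]
    exact ⟨haI, hx, hy⟩
  have hcont : Continuous fun z : ℝ × (Fin n → ℝ) × (Fin n → ℝ) =>
      z.1 • z.2.1 + (1 - z.1) • z.2.2 := by fun_prop
  have := map_mem_closure hcont hmem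
    (t := {x | x ∈ convexHull ℝ S ∧ IsRationalPoint x}) ?_
  · rwa [show b = 1 - a by linarith]
  · rintro ⟨t, u, v⟩ ⟨⟨ht, q, rfl⟩, ⟨hu, hur⟩, hv, hvr⟩
    refine ⟨convex_convexHull ℝ S hu hv ht.1 (sub_nonneg.2 ht.2) (by ring), fun i => ?_⟩
    obtain ⟨r, hr : u i = r⟩ := hur i
    obtain ⟨s, hs : v i = s⟩ := hvr i
    exact ⟨q * r + (1 - q) * s, by simp [hr, hs]⟩

lemma IsRatPolyhedron.subset_cube {n : ℕ} {P : Set (Fin n → ℝ)} (hP : IsRatPolyhedron P) :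
    P ⊆ cube n := by
  obtain ⟨F, hF, rfl⟩ := hP
  exact iUnion₂_subset fun S hS => convexHull_min (fun v hv => (hF S hS v hv).2) (convex_Icc 0 1)

lemma IsRatPolyhedron.isCompact {n : ℕ} {P : Set (Fin n → ℝ)} (hP : IsRatPolyhedron P) :
    IsCompact P := by
  obtain ⟨F, -, rfl⟩ := hP
  exact F.isCompact_biUnion fun S _ => S.finite_toSet.isCompact_convexHull ℝ

lemma IsRatPolyhedron.subset_closure_rational {n : ℕ} {P : Set (Fin n → ℝ)}
    (hP : IsRatPolyhedron P) : P ⊆ closure {x | x ∈ P ∧ IsRationalPoint x} := by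
  obtain ⟨F, hF, rfl⟩ := hP
  refine iUnion₂_subset fun S hS =>
    (convexHull_subset_closure_rational fun v hv => (hF S hS v hv).1).trans (closure_mono ?_)
  exact fun x hx => ⟨mem_biUnion hS hx.1, hx.2⟩

lemma IsRationalPoint.exists_denominator {n : ℕ} {x : Fin n → ℝ} (hx : IsRationalPoint x) :
    ∃ d : ℕ, d ≠ 0 ∧ ∀ i, ∃ k : ℤ, (d : ℝ) * x i = k := by
  choose q hq using hx
  refine ⟨∏ i, (q i).den, Finset.prod_ne_zero_iff.2 fun i _ => (q i).den_nz, fun i => ?_⟩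
  obtain ⟨c, hc⟩ := Finset.dvd_prod_of_mem (fun i => (q i).den) (Finset.mem_univ i)
  refine ⟨c * (q i).num, ?_⟩
  rw [hc, hq]
  have : ((q i).den : ℝ) * (q i : ℝ) = (q i).num := by exact_mod_cast Rat.den_mul_eq_num (q i)
  push_cast
  rw [← this]
  ring

/-- The cube has finitely many points of denominator dividing `d`. -/
lemma finite_denominator {n : ℕ} {X : Set (Fin n → ℝ)} (hX : X ⊆ cube n) {d : ℕ} (hd : d ≠ 0) :
    {x : ↥X | ∀ i, ∃ k : ℤ, (d : ℝ) * x.1 i = k}.Finite := by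
  have hfin : (univ.pi fun _ : Fin n => (fun k : ℤ => (k : ℝ) / d) '' Icc 0 (d : ℤ)).Finite :=
    Finite.pi fun _ => (finite_Icc _ _).image _
  refine (hfin.preimage Subtype.val_injective.injOn).subset fun x hx i _ => ?_
  obtain ⟨k, hk⟩ := hx i
  have hd' : (0 : ℝ) < d := Nat.cast_pos.2 (Nat.pos_of_ne_zero hd)
  have h0 : 0 ≤ x.1 i := (hX x.2).1 i
  have h1 : x.1 i ≤ 1 := (hX x.2).2 i
  refine ⟨k, ⟨?_, ?_⟩, ?_⟩
  · have : (0 : ℝ) ≤ k := hk ▸ by positivity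
    exact_mod_cast this
  · have : (k : ℝ) ≤ d := hk ▸ mul_le_of_le_one_right hd'.le h1
    exact_mod_cast this
  · change (k : ℝ) / d = x.1 i
    rw [← hk]
    field_simp

/-- for every nonempty rational polyhedron `P ⊆ [0,1]^n`, the (finitely
presented) unital ℓ-group `(M_n↾P, 1)` is hopfian: every surjective unital
ℓ-endomorphism is injective. -/
theorem stmt4 {n : ℕ} (hn : 1 ≤ n) (P : Set (Fin n → ℝ))
    (hP : IsRatPolyhedron P) (hne : P.Nonempty) :
    ∀ σ : (↥P → ℝ) → (↥P → ℝ), IsUnitalLEndo P σ →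
      Set.SurjOn σ (Mres P) (Mres P) → Set.InjOn σ (Mres P) := by
  rintro σ ⟨hmaps, hadd, hsup, -, hone⟩ hsurj f hf g hg hfg
  have hX := hP.subset_cube
  have hrat : ∀ y : ↥P, IsRationalPoint y.1 → f y = g y := by
    intro y hy
    obtain ⟨d, hd, hyd⟩ := hy.exists_denominator
    let D : Set ↥P := {x | ∀ i, ∃ k : ℤ, (d : ℝ) * x.1 i = k}
    have hD : D.Finite := finite_denominator hX hd
    have hex : ∀ x : D, ∃ z : ↥P, ∀ f ∈ Mres P, σ f x = f z := fun x =>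
      exists_eq_eval hX hP.isCompact hne (φ := fun f => σ f x)
        (fun f hf g hg => by simp [hadd f hf g hg])
        (fun f hf g hg => by simp [hsup f hf g hg])
        (by simp [hone]) hd
        (fun f hf => exists_int_of_mem_Mres hX (hmaps hf) x.2)
    choose η hη using hex
    have hηD : ∀ x, η x ∈ D := fun x i => by
      rw [← hη x _ (coord_mem_Mres P i)]
      exact exists_int_of_mem_Mres hX (hmaps (coord_mem_Mres P i)) x.2
    have hinj : Function.Injective fun x => (⟨η x, hηD x⟩ : D) := by
      intro x x' h
      have h : η x = η x' := congrArg Subtype.val h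
      refine Subtype.ext (Subtype.ext (funext fun i => ?_))
      obtain ⟨a, ha, hai⟩ := hsurj (coord_mem_Mres P i)
      have := (hη x a ha).trans ((congrArg a h).trans (hη x' a ha).symm)
      rwa [hai] at this
    have : Finite D := hD
    obtain ⟨x, hx⟩ := Finite.surjective_of_injective hinj ⟨y, hyd⟩
    have hx : η x = y := congrArg Subtype.val hx
    rw [← hx, ← hη x f hf, ← hη x g hg, hfg]
  have hdense : Dense {y : ↥P | IsRationalPoint y.1} := fun y => by
    rw [closure_subtype]
    refine closure_mono ?_ (hP.subset_closure_rational y.2)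
    exact fun x hx => ⟨⟨x, hx.1⟩, hx.2, rfl⟩
  exact Continuous.ext_on hdense (continuous_of_mem_Mres hX hf) (continuous_of_mem_Mres hX hg)
    fun y hy => hrat y hy
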